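/- For every integer n ≥ 6 with n ≡ 1 (mod 5) there exists a finite set of n pairwise distinct circles in the Euclidean plane, pairwise not nested, such that any two circles of the set that intersect do so orthogonally, and such that exactly 3n − 8 unordered pairs of circles of the set intersect. -/

import Mathlib

open scoped Classical

/-- A circle in the Euclidean plane, given by a center and a positive radius. -/
structure Circ where
  center : EuclideanSpace ℝ (Fin 2)
  radius : ℝ
  radius_pos : 0 < radius

namespace Circ

/-- The circle as a point set: points at distance exactly `radius` from the center. -/
def points (C : Circ) : Set (EuclideanSpace ℝ (Fin 2)) := Metric.sphere C.center C.radius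

/-- The closed disk bounded by the circle. -/
def closedDisk (C : Circ) : Set (EuclideanSpace ℝ (Fin 2)) := Metric.closedBall C.center C.radius

/-- The open disk bounded by the circle. -/
def openDisk (C : Circ) : Set (EuclideanSpace ℝ (Fin 2)) := Metric.ball C.center C.radius

/-- Two circles intersect if they share a point. -/
def Intersects (A B : Circ) : Prop := (A.points ∩ B.points).Nonempty

/-- Two circles intersect orthogonally. -/
def Orthogonal (A B : Circ) : Prop :=
  Intersects A B ∧ dist A.center B.center ^ 2 = A.radius ^ 2 + B.radius ^ 2

/-- Two circles are nested if the closed disk bounded by one is contained in the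
closed disk bounded by the other. -/
def Nested (A B : Circ) : Prop :=
  A.closedDisk ⊆ B.closedDisk ∨ B.closedDisk ⊆ A.closedDisk

end Circ

open Circ

/-- Number of unordered pairs of circles of `𝒜` that intersect. -/
noncomputable def edgeCount (𝒜 : Finset Circ) : ℕ :=
  ((𝒜.powersetCard 2).filter fun e => ∃ A ∈ e, ∃ B ∈ e, A ≠ B ∧ Intersects A B).card

namespace Circ

theorem Intersects.symm {A B : Circ} (h : Intersects A B) : Intersects B A := by
  rwa [Intersects, Set.inter_comm]

theorem Orthogonal.symm {A B : Circ} (h : Orthogonal A B) : Orthogonal B A :=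
  ⟨h.1.symm, by rw [dist_comm, h.2, add_comm]⟩

theorem dist_sq_eq (x y : EuclideanSpace ℝ (Fin 2)) :
    dist x y ^ 2 = (x 0 - y 0) ^ 2 + (x 1 - y 1) ^ 2 := by
  rw [EuclideanSpace.dist_eq, Real.sq_sqrt (by positivity), Fin.sum_univ_two, Real.dist_eq,
    Real.dist_eq, sq_abs, sq_abs]

theorem orthogonal_of_dist_sq_eq {A B : Circ}
    (h : dist A.center B.center ^ 2 = A.radius ^ 2 + B.radius ^ 2) : Orthogonal A B := by
  refine ⟨?_, h⟩
  have hA := A.radius_pos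
  have hB := B.radius_pos
  have hD : 0 < A.radius ^ 2 + B.radius ^ 2 := by positivity
  rw [dist_sq_eq] at h
  obtain ⟨u, hu⟩ : ∃ u, u = B.center 0 - A.center 0 := ⟨_, rfl⟩
  obtain ⟨v, hv⟩ : ∃ v, v = B.center 1 - A.center 1 := ⟨_, rfl⟩
  have huv : u ^ 2 + v ^ 2 = A.radius ^ 2 + B.radius ^ 2 := by rw [hu, hv, ← h]; ring
  have hB0 : B.center 0 = A.center 0 + u := by rw [hu]; ring
  have hB1 : B.center 1 = A.center 1 + v := by rw [hv]; ring
  obtain ⟨t, ht⟩ : ∃ t, t = A.radius ^ 2 / (A.radius ^ 2 + B.radius ^ 2) := ⟨_, rfl⟩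
  obtain ⟨w, hw⟩ : ∃ w, w = A.radius * B.radius / (A.radius ^ 2 + B.radius ^ 2) := ⟨_, rfl⟩
  refine ⟨!₂[A.center 0 + t * u - w * v, A.center 1 + t * v + w * u], ?_, ?_⟩
  · rw [points, Metric.mem_sphere, ← sq_eq_sq₀ dist_nonneg hA.le, dist_sq_eq]
    have : (t ^ 2 + w ^ 2) * (u ^ 2 + v ^ 2) = A.radius ^ 2 := by
      rw [huv, ht, hw]; field_simp
    simp
    linear_combination this
  · rw [points, Metric.mem_sphere, ← sq_eq_sq₀ dist_nonneg hB.le, dist_sq_eq]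
    have : ((1 - t) ^ 2 + w ^ 2) * (u ^ 2 + v ^ 2) = B.radius ^ 2 := by
      rw [huv, ht, hw]; field_simp; ring
    simp [hB0, hB1]
    linear_combination this

theorem not_intersects_of_lt {A B : Circ}
    (h : (A.radius + B.radius) ^ 2 < dist A.center B.center ^ 2) : ¬ Intersects A B := by
  rintro ⟨p, hA, hB⟩
  have hlt := lt_of_pow_lt_pow_left₀ 2 dist_nonneg h
  rw [points, Metric.mem_sphere] at hA hB
  rw [← hA, ← hB, dist_comm p A.center] at hlt
  exact hlt.not_ge (dist_triangle _ _ _)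

theorem dist_add_radius_le {A B : Circ} (hAB : 0 < dist A.center B.center)
    (h : A.closedDisk ⊆ B.closedDisk) : dist A.center B.center + A.radius ≤ B.radius := by
  have hA := A.radius_pos
  rw [dist_eq_norm] at hAB ⊢
  obtain ⟨v, hv⟩ : ∃ v, v = A.center - B.center := ⟨_, rfl⟩
  rw [← hv] at hAB ⊢
  have hmem : A.center + (A.radius / ‖v‖) • v ∈ A.closedDisk := by
    rw [closedDisk, Metric.mem_closedBall, dist_eq_norm, add_sub_cancel_left, norm_smul,
      Real.norm_of_nonneg (by positivity), div_mul_cancel₀ _ hAB.ne']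
  have hB := h hmem
  have hsub : A.center + (A.radius / ‖v‖) • v - B.center = (1 + A.radius / ‖v‖) • v := by
    rw [add_smul, one_smul, hv]; abel
  rw [closedDisk, Metric.mem_closedBall, dist_eq_norm, hsub, norm_smul,
    Real.norm_of_nonneg (by positivity), add_mul, one_mul, div_mul_cancel₀ _ hAB.ne'] at hB
  exact hB

theorem not_nested_of_le {A B : Circ}
    (h : A.radius ^ 2 + B.radius ^ 2 ≤ dist A.center B.center ^ 2) : ¬ Nested A B := by
  have hA := A.radius_pos
  have hB := B.radius_pos
  have hD : 0 < dist A.center B.center := by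
    refine dist_nonneg.lt_of_ne' fun h0 => ?_
    rw [h0] at h
    nlinarith
  rintro (hs | hs)
  · nlinarith [dist_add_radius_le hD hs]
  · rw [dist_comm] at h hD
    nlinarith [dist_add_radius_le hD hs]

end Circ

theorem edgeCount_insert {s : Finset Circ} {C : Circ} (hC : C ∉ s) :
    edgeCount (insert C s) = edgeCount s + (s.filter fun X => Intersects X C).card := by
  have hne : ∀ {X}, X ∈ s → X ≠ C := fun hX h => hC (h ▸ hX)
  rw [edgeCount, Finset.powersetCard_succ_insert hC, Finset.filter_union,
    Finset.card_union_of_disjoint]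
  · congr 1
    symm
    refine Finset.card_bij (fun X _ => {C, X}) ?_ ?_ ?_
    · intro X hX
      rw [Finset.mem_filter] at hX ⊢
      refine ⟨Finset.mem_image.2 ⟨{X}, by simp [Finset.mem_powersetCard, hX.1], rfl⟩,
        X, by simp, C, by simp, hne hX.1, hX.2⟩
    · intro X hX Y hY h
      have hXY : X ∈ ({C, Y} : Finset Circ) := h ▸ by simp
      rw [Finset.mem_insert, Finset.mem_singleton] at hXY
      exact hXY.resolve_left (hne (Finset.mem_filter.1 hX).1)
    · intro e he
      rw [Finset.mem_filter, Finset.mem_image] at he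
      obtain ⟨⟨t, ht, rfl⟩, A, hA, B, hB, hAB, hI⟩ := he
      obtain ⟨hts, htc⟩ := Finset.mem_powersetCard.1 ht
      obtain ⟨X, rfl⟩ := Finset.card_eq_one.1 htc
      have hX : X ∈ s := hts (by simp)
      refine ⟨X, Finset.mem_filter.2 ⟨hX, ?_⟩, rfl⟩
      simp only [Finset.mem_insert, Finset.mem_singleton] at hA hB
      rcases hA with rfl | rfl <;> rcases hB with rfl | rfl
      · exact absurd rfl hAB
      · exact hI.symm
      · exact hI
      · exact absurd rfl hAB
  · refine Finset.disjoint_left.2 fun e he he' => ?_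
    obtain ⟨t, -, rfl⟩ := Finset.mem_image.1 (Finset.mem_filter.1 he').1
    exact hC ((Finset.mem_powersetCard.1 (Finset.mem_filter.1 he).1).1
      (Finset.mem_insert_self _ _))

theorem edgeCount_image_range {c : ℕ → Circ} (hc : Function.Injective c) (n : ℕ) :
    edgeCount ((Finset.range n).image c) =
      ∑ i ∈ Finset.range n,
        ((Finset.range i).filter fun j => Intersects (c j) (c i)).card := by
  induction n with
  | zero => simp [edgeCount]
  | succ n ih =>
    have hn : c n ∉ (Finset.range n).image c := by
      simp [hc.eq_iff]
    rw [Finset.range_add_one, Finset.image_insert, edgeCount_insert hn, ih,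
      Finset.sum_insert Finset.notMem_range_self, add_comm, Finset.filter_image,
      Finset.card_image_of_injective _ hc]

namespace Rosette

/-- The cosine of `2π / 5`. -/
noncomputable def cosFifth : ℝ := (√5 - 1) / 4

theorem cosFifth_quadratic : 4 * cosFifth ^ 2 = 1 - 2 * cosFifth := by
  have h : √5 ^ 2 = 5 := Real.sq_sqrt (by norm_num)
  rw [cosFifth]
  linear_combination h / 4

theorem lt_cosFifth : 0.306 < cosFifth := by
  have h : 2.225 < √5 := Real.lt_sqrt_of_sq_lt (by norm_num)
  rw [cosFifth]
  linarith

theorem cosFifth_lt : cosFifth < 0.31 := by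
  have h : √5 < 2.24 := (Real.sqrt_lt' (by norm_num)).2 (by norm_num)
  rw [cosFifth]
  linarith

theorem cos_pi_div_five_eq : Real.cos (Real.pi / 5) = cosFifth + 1 / 2 := by
  rw [Real.cos_pi_div_five, cosFifth]
  ring

theorem cos_two_mul_pi_div_five_eq : Real.cos (2 * (Real.pi / 5)) = cosFifth := by
  rw [Real.cos_two_mul, cos_pi_div_five_eq]
  linear_combination cosFifth_quadratic / 2

/-- Cosines of the angles `t * (π / 5)`, for integers `t`. -/
noncomputable def cosStep (t : ℤ) : ℝ := Real.cos (t * (Real.pi / 5))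

theorem cosStep_neg (t : ℤ) : cosStep (-t) = cosStep t := by
  rw [cosStep, cosStep, Int.cast_neg, neg_mul, Real.cos_neg]

theorem cosStep_five_sub (t : ℤ) : cosStep (5 - t) = -cosStep t := by
  rw [cosStep, cosStep, ← Real.cos_pi_sub]
  congr 1
  push_cast
  ring

theorem cosStep_add_ten (t : ℤ) : cosStep (t + 10) = cosStep t := by
  rw [show t + 10 = 5 - (-(5 - -t)) by ring, cosStep_five_sub, cosStep_neg, cosStep_five_sub,
    cosStep_neg, neg_neg]

theorem cosStep_zero : cosStep 0 = 1 := by simp [cosStep]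

theorem cosStep_one : cosStep 1 = cosFifth + 1 / 2 := by
  rw [cosStep, Int.cast_one, one_mul, cos_pi_div_five_eq]

theorem cosStep_two : cosStep 2 = cosFifth := by
  rw [cosStep, Int.cast_ofNat, cos_two_mul_pi_div_five_eq]

theorem cosStep_three : cosStep 3 = -cosFifth := by
  rw [← cosStep_two, ← cosStep_five_sub]; norm_num

theorem cosStep_four : cosStep 4 = -(cosFifth + 1 / 2) := by
  rw [← cosStep_one, ← cosStep_five_sub]; norm_num

theorem cosStep_five : cosStep 5 = -1 := by
  rw [← cosStep_zero, ← cosStep_five_sub]; norm_num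

theorem cosStep_ten_sub (t : ℤ) : cosStep (10 - t) = cosStep t := by
  rw [sub_eq_neg_add, cosStep_add_ten, cosStep_neg]

/-- The ratio of the sizes of two consecutive rings. -/
noncomputable def growth : ℝ := 2 * cosFifth + 2 + √((2 * cosFifth + 2) ^ 2 - 1)

theorem growth_quadratic : cosFifth * (1 + growth ^ 2) = (2 * cosFifth + 1) * growth := by
  have hc := lt_cosFifth
  have h : √((2 * cosFifth + 2) ^ 2 - 1) ^ 2 = (2 * cosFifth + 2) ^ 2 - 1 :=
    Real.sq_sqrt (by nlinarith)
  have hg : growth ^ 2 = (4 * cosFifth + 4) * growth - 1 := by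
    rw [growth]
    linear_combination h
  linear_combination cosFifth * hg + growth * cosFifth_quadratic

theorem five_lt_growth : 5 < growth := by
  have hc := lt_cosFifth
  have h : 2.4 < √((2 * cosFifth + 2) ^ 2 - 1) := Real.lt_sqrt_of_sq_lt (by nlinarith)
  rw [growth]
  linarith

theorem growth_pos : 0 < growth := by linarith [five_lt_growth]

/-- The ratio of the radius of a circle of a ring to the distance of its center from the origin. -/
noncomputable def aperture : ℝ := √(1 - cosFifth)

theorem aperture_sq : aperture ^ 2 = 1 - cosFifth :=
  Real.sq_sqrt (by linarith [cosFifth_lt])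

theorem aperture_pos : 0 < aperture := Real.sqrt_pos.2 (by linarith [cosFifth_lt])

theorem aperture_lt : aperture < 5 / 6 := by
  rw [aperture, Real.sqrt_lt' (by norm_num)]
  linarith [lt_cosFifth]

/-- The `m`-th circle of the `j`-th ring. -/
noncomputable def ringCirc (j m : ℕ) : Circ where
  center := !₂[growth ^ j * Real.cos ((j + 2 * m) * (Real.pi / 5)),
    growth ^ j * Real.sin ((j + 2 * m) * (Real.pi / 5))]
  radius := aperture * growth ^ j
  radius_pos := mul_pos aperture_pos (pow_pos growth_pos j)

/-- The circle centered at the origin that is orthogonal to the circles of the innermost ring. -/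
noncomputable def hub : Circ where
  center := 0
  radius := √cosFifth
  radius_pos := Real.sqrt_pos.2 (by linarith [lt_cosFifth])

theorem dist_sq_ringCirc (i m j l : ℕ) :
    dist (ringCirc i m).center (ringCirc j l).center ^ 2 =
      (growth ^ i) ^ 2 + (growth ^ j) ^ 2
        - 2 * growth ^ i * growth ^ j * cosStep (j - i + 2 * (l - m)) := by
  have hcos : cosStep (j - i + 2 * (l - m)) =
      Real.cos ((j + 2 * l) * (Real.pi / 5) - (i + 2 * m) * (Real.pi / 5)) := by
    rw [cosStep]
    congr 1
    push_cast
    ring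
  rw [hcos, Real.cos_sub, dist_sq_eq]
  simp only [ringCirc, PiLp.toLp_apply, Matrix.cons_val_zero, Matrix.cons_val_one]
  linear_combination (growth ^ i) ^ 2 * Real.sin_sq_add_cos_sq ((i + 2 * m) * (Real.pi / 5))
    + (growth ^ j) ^ 2 * Real.sin_sq_add_cos_sq ((j + 2 * l) * (Real.pi / 5))

theorem dist_sq_hub (j l : ℕ) :
    dist hub.center (ringCirc j l).center ^ 2 = (growth ^ j) ^ 2 := by
  rw [dist_sq_eq]
  simp only [hub, ringCirc, PiLp.zero_apply, PiLp.toLp_apply, Matrix.cons_val_zero,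
    Matrix.cons_val_one]
  linear_combination (growth ^ j) ^ 2 * Real.sin_sq_add_cos_sq ((j + 2 * l) * (Real.pi / 5))

theorem hub_orthogonal (l : ℕ) :
    dist hub.center (ringCirc 0 l).center ^ 2 = hub.radius ^ 2 + (ringCirc 0 l).radius ^ 2 := by
  have hc : √cosFifth ^ 2 = cosFifth := Real.sq_sqrt (by linarith [lt_cosFifth])
  rw [dist_sq_hub]
  simp only [hub, ringCirc, pow_zero, mul_one, aperture_sq, hc]
  ring

theorem hub_separated (j l : ℕ) :
    (hub.radius + (ringCirc (j + 1) l).radius) ^ 2 <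
      dist hub.center (ringCirc (j + 1) l).center ^ 2 := by
  have hx : 5 < growth ^ (j + 1) :=
    five_lt_growth.trans_le (le_self_pow₀ (by linarith [five_lt_growth]) j.succ_ne_zero)
  have hr : √cosFifth < 0.6 := (Real.sqrt_lt' (by norm_num)).2 (by linarith [cosFifth_lt])
  rw [dist_sq_hub]
  refine pow_lt_pow_left₀ ?_ (add_pos hub.radius_pos (ringCirc _ _).radius_pos).le two_ne_zero
  simp only [hub, ringCirc]
  nlinarith [aperture_lt]

theorem ring_orthogonal (j : ℕ) {m l : ℕ} (h : l = m + 1 ∨ l = m + 4) :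
    dist (ringCirc j m).center (ringCirc j l).center ^ 2 =
      (ringCirc j m).radius ^ 2 + (ringCirc j l).radius ^ 2 := by
  have hcos : cosStep (j - j + 2 * (l - m)) = cosFifth := by
    rw [← cosStep_two]
    rcases h with rfl | rfl
    · congr 1; push_cast; ring
    · rw [← cosStep_ten_sub 2]; congr 1; push_cast; ring
  rw [dist_sq_ringCirc, hcos]
  simp only [ringCirc, mul_pow, aperture_sq]
  ring

theorem ring_separated (j : ℕ) {m l : ℕ} (h : l = m + 2 ∨ l = m + 3) :
    ((ringCirc j m).radius + (ringCirc j l).radius) ^ 2 <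
      dist (ringCirc j m).center (ringCirc j l).center ^ 2 := by
  have hcos : cosStep (j - j + 2 * (l - m)) = -(cosFifth + 1 / 2) := by
    rw [← cosStep_four]
    rcases h with rfl | rfl
    · congr 1; push_cast; ring
    · rw [← cosStep_ten_sub 4]; congr 1; push_cast; ring
  have hx : 0 < (growth ^ j) ^ 2 := pow_pos (pow_pos growth_pos j) 2
  rw [dist_sq_ringCirc, hcos]
  have hrad : ((ringCirc j m).radius + (ringCirc j l).radius) ^ 2
      = 4 * (1 - cosFifth) * (growth ^ j) ^ 2 := by
    simp only [ringCirc]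
    linear_combination 4 * (growth ^ j) ^ 2 * aperture_sq
  rw [hrad]
  nlinarith [lt_cosFifth]

theorem succ_ring_orthogonal (j : ℕ) {m l : ℕ} (h : l = m ∨ m = l + 1 ∨ l = m + 4) :
    dist (ringCirc j m).center (ringCirc (j + 1) l).center ^ 2 =
      (ringCirc j m).radius ^ 2 + (ringCirc (j + 1) l).radius ^ 2 := by
  have hcos : cosStep ((j + 1 : ℕ) - j + 2 * (l - m)) = cosFifth + 1 / 2 := by
    rw [← cosStep_one]
    rcases h with rfl | rfl | rfl
    · congr 1; push_cast; ring
    · rw [← cosStep_neg 1]; congr 1; push_cast; ring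
    · rw [← cosStep_ten_sub 1]; congr 1; push_cast; ring
  rw [dist_sq_ringCirc, hcos]
  simp only [ringCirc, mul_pow, aperture_sq, pow_succ growth j]
  linear_combination (growth ^ j) ^ 2 * growth_quadratic

theorem succ_ring_separated (j : ℕ) {m l : ℕ} (hm : m < 5) (hl : l < 5)
    (h : ¬ (l = m ∨ m = l + 1 ∨ l = m + 4)) :
    ((ringCirc j m).radius + (ringCirc (j + 1) l).radius) ^ 2 <
      dist (ringCirc j m).center (ringCirc (j + 1) l).center ^ 2 := by
  have hcos : cosStep ((j + 1 : ℕ) - j + 2 * (l - m)) ≤ -cosFifth := by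
    have hstep : ((j + 1 : ℕ) - j + 2 * (l - m) : ℤ) ∈
        ({3, -3, 10 - 3, -(10 - 3), 5, -5} : Set ℤ) := by
      simp only [Set.mem_insert_iff, Set.mem_singleton_iff]
      omega
    rcases hstep with h | h | h | h | h | h <;> rw [h] <;>
      simp only [cosStep_neg, cosStep_ten_sub, cosStep_three, cosStep_five] <;>
      linarith [cosFifth_lt]
  have hx : 0 < (growth ^ j) ^ 2 := pow_pos (pow_pos growth_pos j) 2
  rw [dist_sq_ringCirc]
  have hrad : ((ringCirc j m).radius + (ringCirc (j + 1) l).radius) ^ 2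
      = (1 - cosFifth) * (1 + growth) ^ 2 * (growth ^ j) ^ 2 := by
    simp only [ringCirc, pow_succ growth j]
    linear_combination (1 + growth) ^ 2 * (growth ^ j) ^ 2 * aperture_sq
  have hg : (1 - cosFifth) * (1 + growth) ^ 2 < 1 + growth ^ 2 + 2 * growth * cosFifth := by
    nlinarith [growth_quadratic, mul_pos growth_pos (sub_pos.2 lt_cosFifth), growth_pos]
  rw [hrad]
  have h1 := mul_lt_mul_of_pos_right hg hx
  have h2 := mul_le_mul_of_nonneg_left hcos
    (mul_pos (mul_pos two_pos growth_pos) hx).le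
  simp only [pow_succ growth j]
  nlinarith

theorem far_ring_separated {i j : ℕ} (m l : ℕ) (h : i + 2 ≤ j) :
    ((ringCirc i m).radius + (ringCirc j l).radius) ^ 2 <
      dist (ringCirc i m).center (ringCirc j l).center ^ 2 := by
  have hx : 0 < growth ^ i := pow_pos growth_pos i
  have hg := five_lt_growth
  have hxy : 25 * growth ^ i < growth ^ j := by
    refine lt_of_lt_of_le ?_ (pow_le_pow_right₀ (by linarith) h)
    rw [pow_add, mul_comm]
    exact mul_lt_mul_of_pos_left (by nlinarith) hx
  have hcos : cosStep (j - i + 2 * (l - m)) ≤ 1 := Real.cos_le_one _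
  refine lt_of_lt_of_le (b := (growth ^ j - growth ^ i) ^ 2) ?_ ?_
  · refine pow_lt_pow_left₀ ?_ (add_pos (ringCirc i m).radius_pos (ringCirc j l).radius_pos).le
      two_ne_zero
    simp only [ringCirc]
    nlinarith [aperture_lt]
  · rw [dist_sq_ringCirc]
    nlinarith [mul_le_mul_of_nonneg_left hcos (mul_pos hx (pow_pos growth_pos j)).le]

/-- The hub followed by the rings, from the inside out. -/
noncomputable def circ : ℕ → Circ
  | 0 => hub
  | i + 1 => ringCirc (i / 5) (i % 5)

/-- The orthogonality relation between `circ a` and `circ b`, for `a < b`. -/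
def Linked : ℕ → ℕ → Prop
  | 0, b => b ≤ 5
  | a + 1, b =>
    (a / 5 = (b - 1) / 5 ∧ ((b - 1) % 5 = a % 5 + 1 ∨ (b - 1) % 5 = a % 5 + 4)) ∨
      (a / 5 + 1 = (b - 1) / 5 ∧
        ((b - 1) % 5 = a % 5 ∨ a % 5 = (b - 1) % 5 + 1 ∨ (b - 1) % 5 = a % 5 + 4))

theorem dist_sq_eq_of_linked {a b : ℕ} (hab : a < b) (h : Linked a b) :
    dist (circ a).center (circ b).center ^ 2 = (circ a).radius ^ 2 + (circ b).radius ^ 2 := by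
  obtain ⟨b, rfl⟩ := Nat.exists_eq_add_one_of_ne_zero hab.ne_bot
  cases a with
  | zero =>
    have hb : b / 5 = 0 := by
      have : b + 1 ≤ 5 := h
      omega
    rw [circ, circ, hb]
    exact hub_orthogonal _
  | succ a =>
    rw [circ, circ]
    rcases h with ⟨h, h'⟩ | ⟨h, h'⟩ <;> rw [add_tsub_cancel_right] at h h'
    · rw [h]
      exact ring_orthogonal _ h'
    · rw [← h]
      exact succ_ring_orthogonal _ h'

theorem lt_dist_sq_of_not_linked {a b : ℕ} (hab : a < b) (h : ¬ Linked a b) :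
    ((circ a).radius + (circ b).radius) ^ 2 < dist (circ a).center (circ b).center ^ 2 := by
  obtain ⟨b, rfl⟩ := Nat.exists_eq_add_one_of_ne_zero hab.ne_bot
  cases a with
  | zero =>
    have hb : b / 5 = (b / 5 - 1) + 1 := by
      have : ¬ b + 1 ≤ 5 := h
      omega
    rw [circ, circ, hb]
    exact hub_separated _ _
  | succ a =>
    rw [circ, circ]
    rw [Linked, add_tsub_cancel_right] at h
    rcases (by omega : a / 5 = b / 5 ∨ a / 5 + 1 = b / 5 ∨ a / 5 + 2 ≤ b / 5) with h' | h' | h'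
    · rw [h']
      exact ring_separated _ (by omega)
    · rw [← h']
      exact succ_ring_separated _ (by omega) (by omega) (by omega)
    · exact far_ring_separated _ _ h'

theorem intersects_iff_linked {a b : ℕ} (hab : a < b) :
    Intersects (circ a) (circ b) ↔ Linked a b :=
  ⟨fun h => by_contra fun hn => not_intersects_of_lt (lt_dist_sq_of_not_linked hab hn) h,
    fun h => (orthogonal_of_dist_sq_eq (dist_sq_eq_of_linked hab h)).1⟩

theorem orthogonal_of_intersects {a b : ℕ} (hab : a ≠ b) (h : Intersects (circ a) (circ b)) :
    Orthogonal (circ a) (circ b) := by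
  rcases hab.lt_or_gt with hlt | hlt
  · exact orthogonal_of_dist_sq_eq (dist_sq_eq_of_linked hlt ((intersects_iff_linked hlt).1 h))
  · exact (orthogonal_of_dist_sq_eq
      (dist_sq_eq_of_linked hlt ((intersects_iff_linked hlt).1 h.symm))).symm

theorem not_nested {a b : ℕ} (hab : a ≠ b) : ¬ Nested (circ a) (circ b) := by
  wlog hlt : a < b generalizing a b
  · exact fun h => this hab.symm (hab.lt_or_gt.resolve_left hlt) h.symm
  refine not_nested_of_le ?_
  by_cases h : Linked a b
  · exact (dist_sq_eq_of_linked hlt h).ge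
  · have hpos := mul_pos (circ a).radius_pos (circ b).radius_pos
    linarith [lt_dist_sq_of_not_linked hlt h, add_sq (circ a).radius (circ b).radius]

theorem circ_injective : Function.Injective circ := fun a b h =>
  by_contra fun hab => not_nested hab (Or.inl (by rw [h]))

theorem card_filter_intersects {b : ℕ} {s : Finset ℕ}
    (h : ∀ a, a ∈ s ↔ a < b ∧ Linked a b) :
    ((Finset.range b).filter fun a => Intersects (circ a) (circ b)).card = s.card := by
  congr 1
  ext a
  rw [Finset.mem_filter, Finset.mem_range, h]
  exact and_congr_right intersects_iff_linked

theorem edgeCount_circ (k : ℕ) :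
    edgeCount ((Finset.range (5 * k + 6)).image circ) = 15 * k + 10 := by
  rw [edgeCount_image_range circ_injective]
  induction k with
  | zero =>
    have h0 := card_filter_intersects (b := 0) (s := ∅) (by simp)
    have h1 := card_filter_intersects (b := 1) (s := {0})
      (by rintro (_ | a) <;> simp [Linked])
    have h2 := card_filter_intersects (b := 2) (s := {0, 1})
      (by rintro (_ | a) <;> simp [Linked]; omega)
    have h3 := card_filter_intersects (b := 3) (s := {0, 2})
      (by rintro (_ | a) <;> simp [Linked]; omega)
    have h4 := card_filter_intersects (b := 4) (s := {0, 3})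
      (by rintro (_ | a) <;> simp [Linked]; omega)
    have h5 := card_filter_intersects (b := 5) (s := {0, 1, 4})
      (by rintro (_ | a) <;> simp [Linked]; omega)
    simp only [mul_zero, zero_add, Finset.sum_range_succ, Finset.sum_range_zero, h0, h1, h2, h3,
      h4, h5]
    rfl
  | succ k ih =>
    have h0 := card_filter_intersects (b := 5 * k + 6) (s := {5 * k + 1, 5 * k + 2})
      (by rintro (_ | a) <;> simp [Linked]; omega)
    have h1 := card_filter_intersects (b := 5 * k + 7) (s := {5 * k + 2, 5 * k + 3, 5 * k + 6})
      (by rintro (_ | a) <;> simp [Linked]; omega)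
    have h2 := card_filter_intersects (b := 5 * k + 8) (s := {5 * k + 3, 5 * k + 4, 5 * k + 7})
      (by rintro (_ | a) <;> simp [Linked]; omega)
    have h3 := card_filter_intersects (b := 5 * k + 9) (s := {5 * k + 4, 5 * k + 5, 5 * k + 8})
      (by rintro (_ | a) <;> simp [Linked]; omega)
    have h4 := card_filter_intersects (b := 5 * k + 10)
      (s := {5 * k + 5, 5 * k + 1, 5 * k + 9, 5 * k + 6})
      (by rintro (_ | a) <;> simp [Linked]; omega)
    rw [show 5 * (k + 1) + 6 = 5 * k + 10 + 1 by ring, Finset.sum_range_succ,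
      Finset.sum_range_succ, Finset.sum_range_succ, Finset.sum_range_succ, Finset.sum_range_succ,
      ih, h0, h1, h2, h3, h4]
    simp [Finset.card_insert_of_notMem]
    ring

end Rosette

theorem stmt17 (n : ℕ) (h6 : 6 ≤ n) (hmod : n % 5 = 1) :
    ∃ 𝒜 : Finset Circ, 𝒜.card = n ∧
      ((𝒜 : Set Circ).Pairwise fun X Y => ¬ Nested X Y) ∧
      ((𝒜 : Set Circ).Pairwise fun X Y => Intersects X Y → Orthogonal X Y) ∧
      edgeCount 𝒜 = 3 * n - 8 := by
  obtain ⟨k, rfl⟩ : ∃ k, n = 5 * k + 6 := ⟨(n - 6) / 5, by omega⟩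
  refine ⟨(Finset.range (5 * k + 6)).image Rosette.circ, ?_, ?_, ?_, ?_⟩
  · rw [Finset.card_image_of_injective _ Rosette.circ_injective, Finset.card_range]
  · rintro X hX Y hY hXY
    obtain ⟨a, -, rfl⟩ := Finset.mem_image.1 (Finset.mem_coe.1 hX)
    obtain ⟨b, -, rfl⟩ := Finset.mem_image.1 (Finset.mem_coe.1 hY)
    exact Rosette.not_nested fun h => hXY (by rw [h])
  · rintro X hX Y hY hXY
    obtain ⟨a, -, rfl⟩ := Finset.mem_image.1 (Finset.mem_coe.1 hX)
    obtain ⟨b, -, rfl⟩ := Finset.mem_image.1 (Finset.mem_coe.1 hY)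
    exact Rosette.orthogonal_of_intersects fun h => hXY (by rw [h])
  · rw [Rosette.edgeCount_circ]
    omega
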